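/- Let p ≥ 0 be an integer and let k = 2p + 1. For every positive integer λ, if there exists a function f : ℤ × ℤ → ℤ with 0 ≤ f(v) ≤ λ - 1 for all v, such that for all distinct u = (u₁,u₂) and v = (v₁,v₂) in ℤ × ℤ, |f(u) - f(v)| ≥ k + 1 - (|u₁ - v₁| + |u₂ - v₂|), then λ ≥ (2/3)·p·(p+1)·(2p+3) + 2. -/

import Mathlib

/-- If the values of `f` on `S` are pairwise separated by at least `K - w u - w v`, then they
spread over at least `(#S - 1) K - 2 ∑ w`: consecutive values in increasing order telescope. -/
theorem exists_max_ge_of_pairwise_separated {ι : Type*} [DecidableEq ι] (f w : ι → ℤ) (K : ℤ)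
    (hw : ∀ v, 0 ≤ w v) (hf : ∀ v, 0 ≤ f v) (S : Finset ι)
    (hsep : ∀ u ∈ S, ∀ v ∈ S, u ≠ v → K - w u - w v ≤ |f u - f v|) (hS : S.Nonempty) :
    ∃ u ∈ S, (∀ v ∈ S, f v ≤ f u) ∧ ∑ v ∈ S, (K - 2 * w v) - K + w u ≤ f u := by
  induction S using Finset.induction_on_max_value f with
  | empty => simp at hS
  | insert a s ha hmax ih =>
    refine ⟨a, Finset.mem_insert_self a s, by simpa using hmax, ?_⟩
    rw [Finset.sum_insert ha]
    rcases s.eq_empty_or_nonempty with rfl | hs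
    · simp only [Finset.sum_empty]
      linarith [hw a, hf a]
    · obtain ⟨u, hu, -, hbound⟩ := ih (fun u hu v hv => hsep u (Finset.mem_insert_of_mem hu) v
        (Finset.mem_insert_of_mem hv)) hs
      have h := hsep a (Finset.mem_insert_self a s) u (Finset.mem_insert_of_mem hu)
        (by rintro rfl; exact ha hu)
      rw [abs_of_nonneg (sub_nonneg.2 (hmax u hu))] at h
      linarith

theorem sum_Icc_neg_succ (g : ℤ → ℤ) (n : ℕ) :
    ∑ x ∈ Finset.Icc (-((n + 1 : ℕ) : ℤ)) ((n + 1 : ℕ) : ℤ), g x =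
      g (-(n + 1)) + g (n + 1) + ∑ x ∈ Finset.Icc (-(n : ℤ)) n, g x := by
  have h : Finset.Icc (-((n + 1 : ℕ) : ℤ)) ((n + 1 : ℕ) : ℤ) =
      insert (-((n : ℤ) + 1)) (insert ((n : ℤ) + 1) (Finset.Icc (-(n : ℤ)) n)) := by
    ext x
    simp only [Finset.mem_insert, Finset.mem_Icc]
    omega
  rw [h, Finset.sum_insert, Finset.sum_insert, add_assoc]
  · simp
  · simp only [Finset.mem_insert, Finset.mem_Icc]
    omega

theorem abs_natCast_add_one (n : ℕ) : |(n : ℤ) + 1| = n + 1 :=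
  abs_of_nonneg (by positivity)

theorem sum_Icc_sub_abs (c : ℤ) (n : ℕ) :
    ∑ x ∈ Finset.Icc (-(n : ℤ)) n, (c - |x|) = (2 * n + 1) * c - n * (n + 1) := by
  induction n with
  | zero => simp
  | succ n ih =>
    rw [sum_Icc_neg_succ, ih, abs_neg, abs_natCast_add_one]
    push_cast
    ring

theorem three_mul_sum_Icc_sub_abs_sq (c : ℤ) (n : ℕ) :
    3 * ∑ x ∈ Finset.Icc (-(n : ℤ)) n, (c - |x|) ^ 2 =
      3 * (2 * n + 1) * c ^ 2 - 6 * c * (n * (n + 1)) + n * (n + 1) * (2 * n + 1) := by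
  induction n with
  | zero => simp
  | succ n ih =>
    rw [sum_Icc_neg_succ, mul_add, ih, abs_neg, abs_natCast_add_one]
    push_cast
    ring

/-- The ball of radius `p` around the origin of the square grid, fibred over the first
coordinate. -/
noncomputable def gridBall (p : ℤ) : Finset (Σ _ : ℤ, ℤ) :=
  (Finset.Icc (-p) p).sigma fun x => Finset.Icc (-(p - |x|)) (p - |x|)

theorem three_mul_sum_gridBall (p : ℤ) (hp : 0 ≤ p) :
    3 * ∑ v ∈ gridBall p, (2 * p + 2 - 2 * (|v.1| + |v.2|)) =
      6 * (p + 1) ^ 2 + 2 * p * (p + 1) * (2 * p + 1) := by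
  have inner : ∀ x ∈ Finset.Icc (-p) p,
      ∑ y ∈ Finset.Icc (-(p - |x|)) (p - |x|), (2 * p + 2 - 2 * (|x| + |y|)) =
        2 * (p + 1 - |x|) ^ 2 := by
    intro x hx
    have hx' : |x| ≤ p := abs_le.2 (Finset.mem_Icc.1 hx)
    obtain ⟨n, hn⟩ := Int.eq_ofNat_of_zero_le (sub_nonneg.2 hx')
    have hp' : p = n + |x| := by linarith
    have h := sum_Icc_sub_abs (n + 1) n
    rw [hn]
    calc ∑ y ∈ Finset.Icc (-(n : ℤ)) n, (2 * p + 2 - 2 * (|x| + |y|))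
        = ∑ y ∈ Finset.Icc (-(n : ℤ)) n, 2 * ((n : ℤ) + 1 - |y|) :=
          Finset.sum_congr rfl fun y _ => by rw [hp']; ring
      _ = 2 * (p + 1 - |x|) ^ 2 := by
          rw [← Finset.mul_sum, h, hp']
          ring
  rw [gridBall, Finset.sum_sigma, Finset.sum_congr rfl inner, ← Finset.mul_sum]
  obtain ⟨n, rfl⟩ := Int.eq_ofNat_of_zero_le hp
  linear_combination 2 * three_mul_sum_Icc_sub_abs_sq ((n : ℤ) + 1) n

/-- The bound multiplied by `3`, so that no rounding occurs. -/
theorem three_mul_lower_bound_odd (p : ℤ) (hp : 0 ≤ p) (lam : ℤ) (f : ℤ × ℤ → ℤ)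
    (hrange : ∀ v : ℤ × ℤ, 0 ≤ f v ∧ f v ≤ lam - 1)
    (hlab : ∀ u v : ℤ × ℤ, u ≠ v →
      2 * p + 1 + 1 - (|u.1 - v.1| + |u.2 - v.2|) ≤ |f u - f v|) :
    2 * p * (p + 1) * (2 * p + 3) + 6 ≤ 3 * lam := by
  rcases hp.eq_or_lt with rfl | hpos
  · have h : 1 ≤ |f (0, 0) - f (0, 1)| := by simpa using hlab (0, 0) (0, 1) (by simp)
    have h₀ := hrange (0, 0)
    have h₁ := hrange (0, 1)
    rcases le_abs.1 h with h | h <;> omega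
  · obtain ⟨u, -, -, hu⟩ := exists_max_ge_of_pairwise_separated
      (fun v : Σ _ : ℤ, ℤ => f (v.1, v.2)) (fun v => |v.1| + |v.2|) (2 * p + 2)
      (fun v => by positivity) (fun v => (hrange _).1) (gridBall p)
      (fun u _ v _ huv => by
        have h := hlab (u.1, u.2) (v.1, v.2) fun h => huv (by
          obtain ⟨a, b⟩ := u
          obtain ⟨c, d⟩ := v
          simpa using h)
        have h₁ := abs_sub u.1 v.1
        have h₂ := abs_sub u.2 v.2
        dsimp only at h ⊢
        linarith)
      ⟨⟨0, 0⟩, by simp [gridBall, hp]⟩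
    have hsum := three_mul_sum_gridBall p hp
    have hmax := (hrange (u.1, u.2)).2
    have hw : 0 ≤ |u.1| + |u.2| := by positivity
    nlinarith

/-- Lower bound on the `L(k, k-1, …, 2, 1)`-labeling number of the square grid
for odd `k = 2p + 1`: any `λ`-labeling forces `λ ≥ (2/3)p(p+1)(2p+3) + 2`. -/
theorem lower_bound_odd (p : ℤ) (hp : 0 ≤ p) (k : ℤ) (hk : k = 2 * p + 1)
    (lam : ℤ) (hlam : 0 < lam)
    (f : ℤ × ℤ → ℤ)
    (hrange : ∀ v : ℤ × ℤ, 0 ≤ f v ∧ f v ≤ lam - 1)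
    (hlab : ∀ u v : ℤ × ℤ, u ≠ v →
      k + 1 - (|u.1 - v.1| + |u.2 - v.2|) ≤ |f u - f v|) :
    2 * p * (p + 1) * (2 * p + 3) / 3 + 2 ≤ lam := by
  subst hk
  have h := three_mul_lower_bound_odd p hp lam f hrange hlab
  omega
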